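/- arXiv:1803.04212 — 12 statements merged into one kernel-verified Lean document; each statement's English description precedes it below -/
import Mathlib

section
/- Let I ⊂ ℝ be an open interval, θ ∈ ℂ a constant, and let q, p, k : I → ℂ be differentiable with k(t) ≠ 0 on I, satisfying q'(t) = p(t) + q(t)² + t/2, p'(t) = −2 p(t) q(t) − θ, and k'(t) = −k(t) q(t) for all t ∈ I. Define H(t) = p(t)²/2 + p(t) q(t)² + p(t) t/2 + q(t) θ. Then for all t ∈ I, H(t) = p(t) q'(t) − H(t) + (d/dt)[ (2/3) H(t) t − (1/3) q(t) p(t) ] − θ k'(t)/k(t). -/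
/-- The Painlevé II Hamiltonian depends on time along a solution only through its explicit
`t`-dependence: `H' = p / 2`. -/
theorem hasDerivAt_painleveII_hamiltonian {θ : ℂ} {q p : ℝ → ℂ} {t : ℝ}
    (hq : HasDerivAt q (p t + (q t) ^ 2 + (t : ℂ) / 2) t)
    (hp : HasDerivAt p (-2 * p t * q t - θ) t) :
    HasDerivAt (fun s : ℝ => (p s) ^ 2 / 2 + p s * (q s) ^ 2 + p s * (s : ℂ) / 2 + q s * θ)
      (p t / 2) t := by
  have ht : HasDerivAt (fun s : ℝ => (s : ℂ)) 1 t := Complex.ofRealCLM.hasDerivAt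
  refine (((((hp.fun_pow 2).div_const 2).fun_add (hp.fun_mul (hq.fun_pow 2))).fun_add
    ((hp.fun_mul ht).div_const 2)).fun_add (hq.mul_const θ)).congr_deriv ?_
  push_cast
  ring

/-- along solutions of the Painlevé II system (with the gauge function `k`),
the Jimbo–Miwa–Ueno logarithmic derivative `H` equals the classical action density
`p q' − H` plus the explicit total derivative `d/dt[(2/3)Ht − (1/3)qp] − θ k'/k`. -/
theorem painleveII_action_identity
    (I : Set ℝ) (hIo : IsOpen I) (hIc : I.OrdConnected) (θ : ℂ)
    (q p k : ℝ → ℂ) (hk0 : ∀ t ∈ I, k t ≠ 0)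
    (hq : ∀ t ∈ I, HasDerivAt q (p t + (q t) ^ 2 + (t : ℂ) / 2) t)
    (hp : ∀ t ∈ I, HasDerivAt p (-2 * p t * q t - θ) t)
    (hk : ∀ t ∈ I, HasDerivAt k (-(k t) * q t) t)
    (H : ℝ → ℂ)
    (hH : ∀ t : ℝ,
      H t = (p t) ^ 2 / 2 + p t * (q t) ^ 2 + p t * (t : ℂ) / 2 + q t * θ) :
    ∀ t ∈ I,
      H t = p t * deriv q t - H t
        + deriv (fun s => (2 / 3) * H s * (s : ℂ) - (1 / 3) * q s * p s) t
        - θ * deriv k t / k t := by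
  intro t ht
  have hHt : HasDerivAt H (p t / 2) t :=
    (funext hH : H = _) ▸ hasDerivAt_painleveII_hamiltonian (hq t ht) (hp t ht)
  have hid : HasDerivAt (fun s : ℝ => (s : ℂ)) 1 t := Complex.ofRealCLM.hasDerivAt
  have hd := ((hHt.const_mul (2 / 3)).fun_mul hid).fun_sub
    (((hq t ht).const_mul (1 / 3)).fun_mul (hp t ht))
  have hlog : θ * (-(k t) * q t) / k t = -(θ * q t) := by
    field_simp [hk0 t ht]
  rw [hd.deriv, (hq t ht).deriv, (hk t ht).deriv, hlog, hH t]
  ring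
end

section
/- Let I ⊂ ℝ be an open interval and let q, p : I → ℂ be differentiable functions satisfying the Painlevé I system q'(t) = p(t) and p'(t) = 6 q(t)² + t for all t ∈ I. Define H(t) = p(t)²/2 − 2 q(t)³ − t q(t). Then for all t ∈ I, 2 H(t) = 2 ( p(t) q'(t) − H(t) ) + (2/5) (d/dt)[ 4 H(t) t − 2 p(t) q(t) ]. -/
/-- along solutions of the Painlevé I system `q' = p`, `p' = 6q² + t`,
with `H = p²/2 − 2q³ − tq`, one has
`2H = 2(p q' − H) + (2/5) d/dt[4Ht − 2pq]`. -/
theorem painleveI_action_identity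
    (I : Set ℝ) (hIo : IsOpen I) (hIc : I.OrdConnected)
    (q p : ℝ → ℂ)
    (hq : ∀ t ∈ I, HasDerivAt q (p t) t)
    (hp : ∀ t ∈ I, HasDerivAt p (6 * (q t) ^ 2 + (t : ℂ)) t)
    (H : ℝ → ℂ)
    (hH : ∀ t : ℝ, H t = (p t) ^ 2 / 2 - 2 * (q t) ^ 3 - (t : ℂ) * q t) :
    ∀ t ∈ I,
      2 * H t = 2 * (p t * deriv q t - H t)
        + (2 / 5) * deriv (fun s => 4 * H s * (s : ℂ) - 2 * p s * q s) t := by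
  intro t ht
  have hqt := hq t ht
  have hpt := hp t ht
  have hid : HasDerivAt (fun s : ℝ => (s : ℂ)) 1 t := Complex.ofRealCLM.hasDerivAt
  have hHt : HasDerivAt H (-q t) t := by
    rw [funext hH]
    refine ((((hpt.fun_pow 2).div_const 2).fun_sub ((hqt.fun_pow 3).const_mul 2)).fun_sub
      (hid.fun_mul hqt)).congr_deriv ?_
    push_cast
    ring
  have hD := ((hHt.const_mul 4).fun_mul hid).fun_sub ((hpt.const_mul 2).fun_mul hqt)
  rw [hD.deriv, hqt.deriv, hH t]
  ring
end

section
/- Let I ⊂ ℝ be an open interval with 0 ∉ I, let θ₀, θ∞ ∈ ℂ be constants, and let q, p : I → ℂ be differentiable functions with q(t) ≠ 0 on I satisfying q'(t) = 4 p(t) q(t)²/t − 2 q(t)² + q(t)(4θ∞ − 1)/t + 2 and p'(t) = −4 p(t)² q(t)/t + p(t)(4 t q(t) − 4θ∞ + 1)/t + 2θ₀ + 2θ∞ for all t ∈ I. Then q is twice differentiable on I and satisfies the third Painlevé equation q'' = (q')²/q − q'/t + (1/t)(α q² + β) + γ q³ + δ/q with α = 8θ₀, β = 4 − 8θ∞,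 γ = 4, δ = −4. -/
/-- solutions of the Painlevé III system satisfy the third Painlevé
equation `q'' = (q')²/q − q'/t + (1/t)(αq² + β) + γq³ + δ/q` with
`α = 8θ₀`, `β = 4 − 8θ∞`, `γ = 4`, `δ = −4`. -/
theorem painleveIII_system_implies_second_order
    (I : Set ℝ) (hIo : IsOpen I) (hIc : I.OrdConnected) (h0 : (0 : ℝ) ∉ I)
    (θ0 θinf : ℂ) (q p : ℝ → ℂ) (hq0 : ∀ t ∈ I, q t ≠ 0)
    (hq : ∀ t ∈ I, HasDerivAt q
      (4 * p t * (q t) ^ 2 / (t : ℂ) - 2 * (q t) ^ 2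
        + q t * (4 * θinf - 1) / (t : ℂ) + 2) t)
    (hp : ∀ t ∈ I, HasDerivAt p
      (-4 * (p t) ^ 2 * q t / (t : ℂ)
        + p t * (4 * (t : ℂ) * q t - 4 * θinf + 1) / (t : ℂ)
        + 2 * θ0 + 2 * θinf) t) :
    ∀ t ∈ I, HasDerivAt (deriv q)
      ((deriv q t) ^ 2 / q t - deriv q t / (t : ℂ)
        + (1 / (t : ℂ)) * ((8 * θ0) * (q t) ^ 2 + (4 - 8 * θinf))
        + 4 * (q t) ^ 3 + (-4) / q t) t := by
  intro t ht
  have ht0 : (t : ℂ) ≠ 0 := by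
    exact_mod_cast fun h : t = 0 => h0 (h ▸ ht)
  have hqt := hq0 t ht
  have hderiv : deriv q =ᶠ[nhds t] fun s : ℝ =>
      4 * p s * (q s) ^ 2 / (s : ℂ) - 2 * (q s) ^ 2
        + q s * (4 * θinf - 1) / (s : ℂ) + 2 := by
    filter_upwards [hIo.mem_nhds ht] with s hs using (hq s hs).deriv
  refine HasDerivAt.congr_of_eventuallyEq ?_ hderiv
  have hid : HasDerivAt (fun s : ℝ => (s : ℂ)) 1 t := Complex.ofRealCLM.hasDerivAt
  have hqd := hq t ht
  have hsq := hqd.fun_pow 2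
  rw [hqd.deriv]
  convert (((((hp t ht).const_mul 4).fun_mul hsq).fun_div hid ht0).fun_sub
    (hsq.const_mul 2)).fun_add ((hqd.mul_const (4 * θinf - 1)).fun_div hid ht0)
    |>.add_const 2 using 1
  push_cast
  field_simp
  ring
end

section
/- Let I ⊂ ℝ be an open interval with 0 ∉ I, and define H : ℂ⁶ × I → ℂ by H(p₁,q₁,p₂,q₂,p₃,q₃,t) = (1/t)( 2p₁²q₁² + p₁(2t − 2tq₁² + (4q₂−1)q₁) − 2tq₁(q₂+q₃) + q₂² − q₃² ). Then differentiable functions p₁,q₁,p₂,q₂,p₃,q₃ : I → ℂ satisfy the extended Painlevé III system q₁' = 4p₁q₁²/t − 2q₁² + q₁(4q₂−1)/t + 2, p₁' = −4p₁²q₁/t + p₁(4tq₁−4q₂+1)/t + 2q₃ + 2q₂, p₂' = −4p₁q₁/t + 2q₁ − 2q₂/t, p₃' = (1/t)(2q₁t + 2q₃), q₂' = 0, q₃' = 0 on I if and only if they satisfy Hamilton's equations qⱼ' = ∂H/∂pⱼ and pⱼ' = −∂H/∂qⱼ for j = 1, 2, 3, with H evaluated along (p₁(t),q₁(t),p₂(t),q₂(t),p₃(t),q₃(t),t).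 -/
/-- The derivative of a function given by a quadratic polynomial. -/
theorem deriv_eq_of_forall_eq_quadratic {f : ℂ → ℂ} (a b c : ℂ)
    (hf : ∀ x, f x = a * x ^ 2 + b * x + c) (x : ℂ) : deriv f x = 2 * a * x + b := by
  have h : HasDerivAt (fun y : ℂ => a * y ^ 2 + b * y + c) (a * (2 * x) + b * 1) x := by
    simpa using ((((hasDerivAt_id x).pow 2).const_mul a).add
      ((hasDerivAt_id x).const_mul b)).add_const c
  rw [funext hf, h.deriv]
  ring

/-- the extended Painlevé III system in Darboux coordinates
`(p₁,q₁,p₂,q₂,p₃,q₃)` is Hamiltonian with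
`H = (1/t)(2p₁²q₁² + p₁(2t − 2tq₁² + (4q₂−1)q₁) − 2tq₁(q₂+q₃) + q₂² − q₃²)`. -/
theorem painleveIII_extended_hamiltonian_iff
    (I : Set ℝ) (hIo : IsOpen I) (hIc : I.OrdConnected) (h0 : (0 : ℝ) ∉ I)
    (H : ℂ → ℂ → ℂ → ℂ → ℂ → ℂ → ℝ → ℂ)
    (hH : ∀ (P1 Q1 P2 Q2 P3 Q3 : ℂ) (t : ℝ),
      H P1 Q1 P2 Q2 P3 Q3 t = (1 / (t : ℂ)) *
        (2 * P1 ^ 2 * Q1 ^ 2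
          + P1 * (2 * (t : ℂ) - 2 * (t : ℂ) * Q1 ^ 2 + (4 * Q2 - 1) * Q1)
          - 2 * (t : ℂ) * Q1 * (Q2 + Q3) + Q2 ^ 2 - Q3 ^ 2))
    (p₁ q₁ p₂ q₂ p₃ q₃ : ℝ → ℂ)
    (hp₁d : ∀ t ∈ I, DifferentiableAt ℝ p₁ t)
    (hq₁d : ∀ t ∈ I, DifferentiableAt ℝ q₁ t)
    (hp₂d : ∀ t ∈ I, DifferentiableAt ℝ p₂ t)
    (hq₂d : ∀ t ∈ I, DifferentiableAt ℝ q₂ t)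
    (hp₃d : ∀ t ∈ I, DifferentiableAt ℝ p₃ t)
    (hq₃d : ∀ t ∈ I, DifferentiableAt ℝ q₃ t) :
    (∀ t ∈ I,
        HasDerivAt q₁
          (4 * p₁ t * (q₁ t) ^ 2 / (t : ℂ) - 2 * (q₁ t) ^ 2
            + q₁ t * (4 * q₂ t - 1) / (t : ℂ) + 2) t ∧
        HasDerivAt p₁
          (-4 * (p₁ t) ^ 2 * q₁ t / (t : ℂ)
            + p₁ t * (4 * (t : ℂ) * q₁ t - 4 * q₂ t + 1) / (t : ℂ)
            + 2 * q₃ t + 2 * q₂ t) t ∧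
        HasDerivAt p₂
          (-4 * p₁ t * q₁ t / (t : ℂ) + 2 * q₁ t - 2 * q₂ t / (t : ℂ)) t ∧
        HasDerivAt p₃
          ((1 / (t : ℂ)) * (2 * q₁ t * (t : ℂ) + 2 * q₃ t)) t ∧
        HasDerivAt q₂ 0 t ∧
        HasDerivAt q₃ 0 t) ↔
    (∀ t ∈ I,
        (HasDerivAt q₁
            (deriv (fun x => H x (q₁ t) (p₂ t) (q₂ t) (p₃ t) (q₃ t) t) (p₁ t)) t ∧
         HasDerivAt p₁
            (-(deriv (fun x => H (p₁ t) x (p₂ t) (q₂ t) (p₃ t) (q₃ t) t) (q₁ t))) t) ∧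
        (HasDerivAt q₂
            (deriv (fun x => H (p₁ t) (q₁ t) x (q₂ t) (p₃ t) (q₃ t) t) (p₂ t)) t ∧
         HasDerivAt p₂
            (-(deriv (fun x => H (p₁ t) (q₁ t) (p₂ t) x (p₃ t) (q₃ t) t) (q₂ t))) t) ∧
        (HasDerivAt q₃
            (deriv (fun x => H (p₁ t) (q₁ t) (p₂ t) (q₂ t) x (q₃ t) t) (p₃ t)) t ∧
         HasDerivAt p₃
            (-(deriv (fun x => H (p₁ t) (q₁ t) (p₂ t) (q₂ t) (p₃ t) x t) (q₃ t))) t)) := by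
  refine forall₂_congr fun t ht => ?_
  have ht0 : (t : ℂ) ≠ 0 := by
    rintro h
    exact h0 (Complex.ofReal_eq_zero.mp h ▸ ht)
  have hP1 := deriv_eq_of_forall_eq_quadratic
    (f := fun x => H x (q₁ t) (p₂ t) (q₂ t) (p₃ t) (q₃ t) t)
    (2 * q₁ t ^ 2 / t) ((2 * t - 2 * t * q₁ t ^ 2 + (4 * q₂ t - 1) * q₁ t) / t)
    ((-2 * t * q₁ t * (q₂ t + q₃ t) + q₂ t ^ 2 - q₃ t ^ 2) / t)
    (fun x => by simp only [hH]; ring) (p₁ t)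
  have hQ1 := deriv_eq_of_forall_eq_quadratic
    (f := fun x => H (p₁ t) x (p₂ t) (q₂ t) (p₃ t) (q₃ t) t)
    ((2 * p₁ t ^ 2 - 2 * t * p₁ t) / t)
    ((p₁ t * (4 * q₂ t - 1) - 2 * t * (q₂ t + q₃ t)) / t)
    ((2 * t * p₁ t + q₂ t ^ 2 - q₃ t ^ 2) / t)
    (fun x => by simp only [hH]; ring) (q₁ t)
  have hQ2 := deriv_eq_of_forall_eq_quadratic
    (f := fun x => H (p₁ t) (q₁ t) (p₂ t) x (p₃ t) (q₃ t) t)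
    (1 / t) ((4 * p₁ t * q₁ t - 2 * t * q₁ t) / t)
    ((2 * p₁ t ^ 2 * q₁ t ^ 2 + p₁ t * (2 * t - 2 * t * q₁ t ^ 2 - q₁ t)
      - 2 * t * q₁ t * q₃ t - q₃ t ^ 2) / t)
    (fun x => by simp only [hH]; ring) (q₂ t)
  have hQ3 := deriv_eq_of_forall_eq_quadratic
    (f := fun x => H (p₁ t) (q₁ t) (p₂ t) (q₂ t) (p₃ t) x t)
    (-1 / t) (-2 * t * q₁ t / t)
    ((2 * p₁ t ^ 2 * q₁ t ^ 2
      + p₁ t * (2 * t - 2 * t * q₁ t ^ 2 + (4 * q₂ t - 1) * q₁ t)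
      - 2 * t * q₁ t * q₂ t + q₂ t ^ 2) / t)
    (fun x => by simp only [hH]; ring) (q₃ t)
  have hP2 : deriv (fun x => H (p₁ t) (q₁ t) x (q₂ t) (p₃ t) (q₃ t) t) (p₂ t) = 0 := by
    simp only [hH, deriv_const]
  have hP3 : deriv (fun x => H (p₁ t) (q₁ t) (p₂ t) (q₂ t) x (q₃ t) t) (p₃ t) = 0 := by
    simp only [hH, deriv_const]
  have eq₁ : 4 * p₁ t * (q₁ t) ^ 2 / (t : ℂ) - 2 * (q₁ t) ^ 2
      + q₁ t * (4 * q₂ t - 1) / (t : ℂ) + 2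
      = deriv (fun x => H x (q₁ t) (p₂ t) (q₂ t) (p₃ t) (q₃ t) t) (p₁ t) := by
    rw [hP1]; field_simp; ring
  have ep₁ : -4 * (p₁ t) ^ 2 * q₁ t / (t : ℂ)
      + p₁ t * (4 * (t : ℂ) * q₁ t - 4 * q₂ t + 1) / (t : ℂ) + 2 * q₃ t + 2 * q₂ t
      = -deriv (fun x => H (p₁ t) x (p₂ t) (q₂ t) (p₃ t) (q₃ t) t) (q₁ t) := by
    rw [hQ1]; field_simp; ring
  have ep₂ : -4 * p₁ t * q₁ t / (t : ℂ) + 2 * q₁ t - 2 * q₂ t / (t : ℂ)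
      = -deriv (fun x => H (p₁ t) (q₁ t) (p₂ t) x (p₃ t) (q₃ t) t) (q₂ t) := by
    rw [hQ2]; field_simp; ring
  have ep₃ : (1 / (t : ℂ)) * (2 * q₁ t * (t : ℂ) + 2 * q₃ t)
      = -deriv (fun x => H (p₁ t) (q₁ t) (p₂ t) (q₂ t) (p₃ t) x t) (q₃ t) := by
    rw [hQ3]; field_simp; ring
  rw [eq₁, ep₁, ep₂, ep₃, hP2, hP3]
  tauto
end

section
/- Let I ⊂ ℝ be an open interval with 0 ∉ I, let θ₀, θ∞ ∈ ℂ be constants, and let q, p, k, a : I → ℂ be differentiable with k(t) ≠ 0 and a(t) ≠ 0 on I, satisfying q' = 4pq²/t − 2q² + q(4θ∞−1)/t + 2, p' = −4p²q/t + p(4tq−4θ∞+1)/t + 2θ₀ + 2θ∞, k' = k(−4pq/t + 2q − 2θ∞/t), and a' = (a/t)(2qt + 2θ₀) on I. Define H(t) = (1/t)( 2p(t)²q(t)² + p(t)(2t − 2tq(t)² + (4θ∞−1)q(t)) − 2tq(t)(θ₀+θ∞) + θ∞² − θ₀² ). Then for all t ∈ I, H(t) + p(t)q(t)/t − t = p(t)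 q'(t) − H(t) + (d/dt)[ H(t) t − t²/2 ] − θ∞ k'(t)/k(t) − θ₀ a'(t)/a(t). -/
/-- along solutions of the Painlevé III system (with gauge functions
`k`, `a`), the Jimbo–Miwa–Ueno logarithmic derivative `H + pq/t − t` equals the
classical action density `p q' − H` plus the explicit total derivative
`d/dt[Ht − t²/2] − θ∞ k'/k − θ₀ a'/a`. -/
theorem painleveIII_action_identity
    (I : Set ℝ) (hIo : IsOpen I) (hIc : I.OrdConnected) (h0 : (0 : ℝ) ∉ I)
    (θ0 θinf : ℂ) (q p k a : ℝ → ℂ)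
    (hk0 : ∀ t ∈ I, k t ≠ 0) (ha0 : ∀ t ∈ I, a t ≠ 0)
    (hq : ∀ t ∈ I, HasDerivAt q
      (4 * p t * (q t) ^ 2 / (t : ℂ) - 2 * (q t) ^ 2
        + q t * (4 * θinf - 1) / (t : ℂ) + 2) t)
    (hp : ∀ t ∈ I, HasDerivAt p
      (-4 * (p t) ^ 2 * q t / (t : ℂ)
        + p t * (4 * (t : ℂ) * q t - 4 * θinf + 1) / (t : ℂ)
        + 2 * θ0 + 2 * θinf) t)
    (hk : ∀ t ∈ I, HasDerivAt k
      (k t * (-4 * p t * q t / (t : ℂ) + 2 * q t - 2 * θinf / (t : ℂ))) t)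
    (ha : ∀ t ∈ I, HasDerivAt a
      ((a t / (t : ℂ)) * (2 * q t * (t : ℂ) + 2 * θ0)) t)
    (H : ℝ → ℂ)
    (hH : ∀ t : ℝ,
      H t = (1 / (t : ℂ)) *
        (2 * (p t) ^ 2 * (q t) ^ 2
          + p t * (2 * (t : ℂ) - 2 * (t : ℂ) * (q t) ^ 2 + (4 * θinf - 1) * q t)
          - 2 * (t : ℂ) * q t * (θ0 + θinf) + θinf ^ 2 - θ0 ^ 2)) :
    ∀ t ∈ I,
      H t + p t * q t / (t : ℂ) - (t : ℂ)
        = p t * deriv q t - H t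
          + deriv (fun s => H s * (s : ℂ) - (s : ℂ) ^ 2 / 2) t
          - θinf * deriv k t / k t - θ0 * deriv a t / a t := by
  intro t ht
  have htr : t ≠ 0 := fun h => h0 (h ▸ ht)
  have htc : (t : ℂ) ≠ 0 := Complex.ofReal_ne_zero.mpr htr
  have hid : HasDerivAt (fun s : ℝ => (s : ℂ)) 1 t := Complex.ofRealCLM.hasDerivAt
  have hQ := hq t ht
  have hP := hp t ht
  have hk0t := hk0 t ht
  have ha0t := ha0 t ht
  have hG := ((((((hP.fun_pow 2).const_mul 2).fun_mul (hQ.fun_pow 2)).fun_add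
    (hP.fun_mul (((hid.const_mul 2).fun_sub ((hid.const_mul 2).fun_mul (hQ.fun_pow 2))).fun_add
      (hQ.const_mul (4 * θinf - 1))))).fun_sub
    (((hid.const_mul 2).fun_mul hQ).mul_const (θ0 + θinf))).add_const (θinf ^ 2 - θ0 ^ 2)).fun_sub
    ((hid.fun_pow 2).div_const 2)
  have heq : (fun s : ℝ => H s * (s : ℂ) - (s : ℂ) ^ 2 / 2) =ᶠ[nhds t] fun s : ℝ =>
      2 * p s ^ 2 * q s ^ 2
        + p s * (2 * (s : ℂ) - 2 * (s : ℂ) * q s ^ 2 + (4 * θinf - 1) * q s)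
        - 2 * (s : ℂ) * q s * (θ0 + θinf) + (θinf ^ 2 - θ0 ^ 2) - (s : ℂ) ^ 2 / 2 := by
    filter_upwards [eventually_ne_nhds htr] with s hs
    have hsc : (s : ℂ) ≠ 0 := Complex.ofReal_ne_zero.mpr hs
    rw [hH s]
    field_simp
    ring
  rw [(hG.congr_of_eventuallyEq heq).deriv, hQ.deriv, (hk t ht).deriv, (ha t ht).deriv, hH t]
  push_cast
  field_simp
  ring
end

section
/- Let I ⊂ ℝ be an open interval, let θ₀, θ∞ ∈ ℂ be constants, and let q, p, k, a : I → ℂ be differentiable with q(t) ≠ 0, k(t) ≠ 0, a(t) ≠ 0 on I, satisfying the Painlevé IV system q' = 4pq, p' = −2p² + (3/8)q² + qt + t²/2 − θ∞ + 1/2 − 2θ₀²/q², k' = −(q + 2t)k, a' = (4θ₀/q)a on I. Define H(t) = 2p(t)²q(t) − q(t)³/8 − t q(t)²/2 + (1/2)(2θ∞ − 1 − t²)q(t) + 2θ∞ t − 2θ₀²/q(t). Then for all t ∈ I, H(t) + q(t)/2 = p(t) q'(t) − H(t) + (d/dt)[ H(t) t/2 − p(t) q(t)/2 ] − θ∞ k'(t)/k(t)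 − θ₀ a'(t)/a(t). -/
/-- Along a solution of the Painlevé IV system the total derivative of the Hamiltonian is its
explicit time derivative. -/
theorem hasDerivAt_painleveIV_hamiltonian {θ0 θinf : ℂ} {q p : ℝ → ℂ} {t : ℝ} (hq0 : q t ≠ 0)
    (hq : HasDerivAt q (4 * p t * q t) t)
    (hp : HasDerivAt p
      (-2 * (p t) ^ 2 + (3 / 8) * (q t) ^ 2 + q t * (t : ℂ) + (t : ℂ) ^ 2 / 2
        - θinf + 1 / 2 - 2 * θ0 ^ 2 / (q t) ^ 2) t) :
    HasDerivAt (fun s : ℝ => 2 * (p s) ^ 2 * q s - (q s) ^ 3 / 8 - (s : ℂ) * (q s) ^ 2 / 2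
        + (1 / 2) * (2 * θinf - 1 - (s : ℂ) ^ 2) * q s + 2 * θinf * (s : ℂ)
        - 2 * θ0 ^ 2 / q s)
      (-(q t) ^ 2 / 2 - (t : ℂ) * q t + 2 * θinf) t := by
  have ht : HasDerivAt (fun s : ℝ => (s : ℂ)) 1 t := Complex.ofRealCLM.hasDerivAt
  have h := ((((((hp.fun_pow 2).const_mul 2).fun_mul hq).fun_sub ((hq.fun_pow 3).div_const 8)).fun_sub
    ((ht.fun_mul (hq.fun_pow 2)).div_const 2)).fun_add
    ((((ht.fun_pow 2).const_sub (2 * θinf - 1)).const_mul (1 / 2)).fun_mul hq)).fun_add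
    (ht.const_mul (2 * θinf)) |>.fun_sub ((hasDerivAt_const t (2 * θ0 ^ 2)).fun_div hq hq0)
  refine h.congr_deriv ?_
  field_simp
  norm_num
  ring


/-- along solutions of the Painlevé IV system (with gauge functions
`k`, `a`), the Jimbo–Miwa–Ueno logarithmic derivative `H + q/2` equals the classical
action density `p q' − H` plus `d/dt[Ht/2 − pq/2] − θ∞ k'/k − θ₀ a'/a`. -/
theorem painleveIV_action_identity
    (I : Set ℝ) (hIo : IsOpen I) (hIc : I.OrdConnected)
    (θ0 θinf : ℂ) (q p k a : ℝ → ℂ)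
    (hq0 : ∀ t ∈ I, q t ≠ 0)
    (hk0 : ∀ t ∈ I, k t ≠ 0) (ha0 : ∀ t ∈ I, a t ≠ 0)
    (hq : ∀ t ∈ I, HasDerivAt q (4 * p t * q t) t)
    (hp : ∀ t ∈ I, HasDerivAt p
      (-2 * (p t) ^ 2 + (3 / 8) * (q t) ^ 2 + q t * (t : ℂ) + (t : ℂ) ^ 2 / 2
        - θinf + 1 / 2 - 2 * θ0 ^ 2 / (q t) ^ 2) t)
    (hk : ∀ t ∈ I, HasDerivAt k (-(q t + 2 * (t : ℂ)) * k t) t)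
    (ha : ∀ t ∈ I, HasDerivAt a ((4 * θ0 / q t) * a t) t)
    (H : ℝ → ℂ)
    (hH : ∀ t : ℝ,
      H t = 2 * (p t) ^ 2 * q t - (q t) ^ 3 / 8 - (t : ℂ) * (q t) ^ 2 / 2
        + (1 / 2) * (2 * θinf - 1 - (t : ℂ) ^ 2) * q t + 2 * θinf * (t : ℂ)
        - 2 * θ0 ^ 2 / q t) :
    ∀ t ∈ I,
      H t + q t / 2
        = p t * deriv q t - H t
          + deriv (fun s => H s * (s : ℂ) / 2 - p s * q s / 2) t
          - θinf * deriv k t / k t - θ0 * deriv a t / a t := by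
  intro t htI
  have hqt := hq0 t htI
  have hkt := hk0 t htI
  have hat := ha0 t htI
  have ht : HasDerivAt (fun s : ℝ => (s : ℂ)) 1 t := Complex.ofRealCLM.hasDerivAt
  have hH' : HasDerivAt H (-(q t) ^ 2 / 2 - (t : ℂ) * q t + 2 * θinf) t := by
    rw [funext hH]
    exact hasDerivAt_painleveIV_hamiltonian hqt (hq t htI) (hp t htI)
  rw [(((hH'.fun_mul ht).div_const 2).fun_sub
      (((hp t htI).fun_mul (hq t htI)).div_const 2)).deriv,
    (hq t htI).deriv, (hk t htI).deriv, (ha t htI).deriv, hH t]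
  field_simp
  ring
end

section
/- Let I ⊂ ℝ be an open interval with 0 ∉ I, let θ₀, θ₁, θ∞ ∈ ℂ be constants, and let q, p : I → ℂ be differentiable functions with q(t) ≠ 0 and q(t) ≠ 1 on I satisfying q' = 2pq(q−1)²/t + (q²/t)(θ₀+3θ₁+θ∞) + (q/t)(t−2θ∞−4θ₁) + (1/t)(θ∞+θ₁−θ₀) and p' = −(p²/t)(3q²−4q+1) − p( (2q/t)(θ₀+3θ₁+θ∞) + (1/t)(t−2θ∞−4θ₁) ) − (2θ₁/t)(θ∞+θ₁+θ₀) for all t ∈ I. Then q is twice differentiable on I and satisfies the fifth Painlevé equation q'' = (1/(2q) + 1/(q−1))(q')² − q'/t + ((q−1)²/t²)(α q + β/q) + γ q/t + δ q(q+1)/(q−1), with α = (θ₀−θ₁+θ∞)²/2, β = −(θ₀−θ₁−θ∞)²/2, γ = 1 − 2θ₀ − 2θ₁, δ = −1/2. -/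
/-- solutions of the Painlevé V system satisfy the fifth Painlevé
equation with `α = (θ₀−θ₁+θ∞)²/2`, `β = −(θ₀−θ₁−θ∞)²/2`, `γ = 1−2θ₀−2θ₁`,
`δ = −1/2`. -/
theorem painleveV_system_implies_second_order
    (I : Set ℝ) (hIo : IsOpen I) (hIc : I.OrdConnected) (h0 : (0 : ℝ) ∉ I)
    (θ0 θ1 θinf : ℂ) (q p : ℝ → ℂ)
    (hq0 : ∀ t ∈ I, q t ≠ 0) (hq1 : ∀ t ∈ I, q t ≠ 1)
    (hq : ∀ t ∈ I, HasDerivAt q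
      (2 * p t * q t * (q t - 1) ^ 2 / (t : ℂ)
        + ((q t) ^ 2 / (t : ℂ)) * (θ0 + 3 * θ1 + θinf)
        + (q t / (t : ℂ)) * ((t : ℂ) - 2 * θinf - 4 * θ1)
        + (1 / (t : ℂ)) * (θinf + θ1 - θ0)) t)
    (hp : ∀ t ∈ I, HasDerivAt p
      (-((p t) ^ 2 / (t : ℂ)) * (3 * (q t) ^ 2 - 4 * q t + 1)
        - p t * ((2 * q t / (t : ℂ)) * (θ0 + 3 * θ1 + θinf)
          + (1 / (t : ℂ)) * ((t : ℂ) - 2 * θinf - 4 * θ1))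
        - (2 * θ1 / (t : ℂ)) * (θinf + θ1 + θ0)) t) :
    ∀ t ∈ I, HasDerivAt (deriv q)
      ((1 / (2 * q t) + 1 / (q t - 1)) * (deriv q t) ^ 2 - deriv q t / (t : ℂ)
        + ((q t - 1) ^ 2 / (t : ℂ) ^ 2) *
            (((θ0 - θ1 + θinf) ^ 2 / 2) * q t + (-(θ0 - θ1 - θinf) ^ 2 / 2) / q t)
        + (1 - 2 * θ0 - 2 * θ1) * q t / (t : ℂ)
        + (-(1 : ℂ) / 2) * q t * (q t + 1) / (q t - 1)) t := by
  intro t ht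
  have ht0 : (t : ℂ) ≠ 0 :=
    Complex.ofReal_ne_zero.2 (ne_of_mem_of_not_mem ht h0)
  have hqt := hq0 t ht
  have hqt1 : q t - 1 ≠ 0 := sub_ne_zero.2 (hq1 t ht)
  have hQ := hq t ht
  have hT : HasDerivAt (fun s : ℝ => (s : ℂ)) 1 t := Complex.ofRealCLM.hasDerivAt
  have hderiv : deriv q =ᶠ[nhds t] fun s =>
      (2 * p s * q s * (q s - 1) ^ 2 + (q s) ^ 2 * (θ0 + 3 * θ1 + θinf)
        + q s * ((s : ℂ) - 2 * θinf - 4 * θ1) + (θinf + θ1 - θ0)) / (s : ℂ) := by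
    filter_upwards [hIo.mem_nhds ht] with s hs
    rw [(hq s hs).deriv]
    ring
  refine HasDerivAt.congr_of_eventuallyEq ?_ hderiv
  have hnum := ((((((hp t ht).const_mul 2).mul hQ).mul ((hQ.sub_const 1).pow 2)).add
    ((hQ.pow 2).mul_const (θ0 + 3 * θ1 + θinf))).add
    (hQ.mul ((hT.sub_const (2 * θinf)).sub_const (4 * θ1)))).add_const (θinf + θ1 - θ0)
  refine (hnum.div hT ht0).congr_deriv ?_
  rw [hQ.deriv]
  simp only [Pi.mul_apply, Pi.add_apply, Pi.pow_apply]
  field_simp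
  ring
end

section
/- Let I ⊂ ℝ be an open interval with 0 ∉ I, let θ₀, θ₁, θ∞ ∈ ℂ be constants, and let q, p, k, a, b : I → ℂ be differentiable with k(t) ≠ 0, a(t) ≠ 0, b(t) ≠ 0 on I, satisfying the Painlevé V system q' = 2pq(q−1)²/t + (q²/t)(θ₀+3θ₁+θ∞) + (q/t)(t−2θ∞−4θ₁) + (1/t)(θ∞+θ₁−θ₀), p' = −(p²/t)(3q²−4q+1) − p((2q/t)(θ₀+3θ₁+θ∞) + (1/t)(t−2θ∞−4θ₁)) − (2θ₁/t)(θ∞+θ₁+θ₀), together with k' = −(k/t)(pq² − 2pq + p + 2θ₁q − 2θ∞ − 2θ₁), a' = (a/t)(p − pq² − 2θ₁q − 2θ₀), b' = −(b/t)(3pq² + p − 4pq + 2θ∞q + 4θ₁q + 2θ₀q − 2θ∞ − 2θ₁ + t) on I. Define H(t) = p(t)²(q(t)−1)²q(t)/t + p(t)( (q(t)²/t)(θ₀+3θ₁+θ∞) + (q(t)/t)(t−2θ∞−4θ₁) + (1/t)(θ∞+θ₁−θ₀) ) + (2θ₁q(t)/t)(θ∞+θ₁+θ₀) + (θ₀²−θ₁²−θ∞²+θ₁t−2θ₁θ∞)/t.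 Then for all t ∈ I, H(t) = p(t) q'(t) − H(t) + (d/dt)[ H(t) t ] − θ∞ k'(t)/k(t) − θ₀ a'(t)/a(t) − θ₁ b'(t)/b(t). -/
/-- along solutions of the Painlevé V system (with gauge functions
`k`, `a`, `b`), the Jimbo–Miwa–Ueno logarithmic derivative `H` equals the classical
action density `p q' − H` plus `d/dt[Ht] − θ∞ k'/k − θ₀ a'/a − θ₁ b'/b`. -/
theorem painleveV_action_identity
    (I : Set ℝ) (hIo : IsOpen I) (hIc : I.OrdConnected) (h0 : (0 : ℝ) ∉ I)
    (θ0 θ1 θinf : ℂ) (q p k a b : ℝ → ℂ)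
    (hk0 : ∀ t ∈ I, k t ≠ 0) (ha0 : ∀ t ∈ I, a t ≠ 0) (hb0 : ∀ t ∈ I, b t ≠ 0)
    (hq : ∀ t ∈ I, HasDerivAt q
      (2 * p t * q t * (q t - 1) ^ 2 / (t : ℂ)
        + ((q t) ^ 2 / (t : ℂ)) * (θ0 + 3 * θ1 + θinf)
        + (q t / (t : ℂ)) * ((t : ℂ) - 2 * θinf - 4 * θ1)
        + (1 / (t : ℂ)) * (θinf + θ1 - θ0)) t)
    (hp : ∀ t ∈ I, HasDerivAt p
      (-((p t) ^ 2 / (t : ℂ)) * (3 * (q t) ^ 2 - 4 * q t + 1)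
        - p t * ((2 * q t / (t : ℂ)) * (θ0 + 3 * θ1 + θinf)
          + (1 / (t : ℂ)) * ((t : ℂ) - 2 * θinf - 4 * θ1))
        - (2 * θ1 / (t : ℂ)) * (θinf + θ1 + θ0)) t)
    (hk : ∀ t ∈ I, HasDerivAt k
      (-(k t / (t : ℂ)) * (p t * (q t) ^ 2 - 2 * p t * q t + p t
        + 2 * θ1 * q t - 2 * θinf - 2 * θ1)) t)
    (ha : ∀ t ∈ I, HasDerivAt a
      ((a t / (t : ℂ)) * (p t - p t * (q t) ^ 2 - 2 * θ1 * q t - 2 * θ0)) t)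
    (hb : ∀ t ∈ I, HasDerivAt b
      (-(b t / (t : ℂ)) * (3 * p t * (q t) ^ 2 + p t - 4 * p t * q t
        + 2 * θinf * q t + 4 * θ1 * q t + 2 * θ0 * q t - 2 * θinf - 2 * θ1 + (t : ℂ))) t)
    (H : ℝ → ℂ)
    (hH : ∀ t : ℝ,
      H t = (p t) ^ 2 * (q t - 1) ^ 2 * q t / (t : ℂ)
        + p t * (((q t) ^ 2 / (t : ℂ)) * (θ0 + 3 * θ1 + θinf)
            + (q t / (t : ℂ)) * ((t : ℂ) - 2 * θinf - 4 * θ1)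
            + (1 / (t : ℂ)) * (θinf + θ1 - θ0))
        + (2 * θ1 * q t / (t : ℂ)) * (θinf + θ1 + θ0)
        + (θ0 ^ 2 - θ1 ^ 2 - θinf ^ 2 + θ1 * (t : ℂ) - 2 * θ1 * θinf) / (t : ℂ)) :
    ∀ t ∈ I,
      H t = p t * deriv q t - H t + deriv (fun s => H s * (s : ℂ)) t
        - θinf * deriv k t / k t - θ0 * deriv a t / a t - θ1 * deriv b t / b t := by
  intro t ht
  have ht0 : (t : ℂ) ≠ 0 := by
    exact_mod_cast fun h : t = 0 => h0 (h ▸ ht)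
  have hk0t := hk0 t ht
  have ha0t := ha0 t ht
  have hb0t := hb0 t ht
  have hcast : HasDerivAt (fun s : ℝ => (s : ℂ)) 1 t := Complex.ofRealCLM.hasDerivAt
  -- Along the flow, `d/dt (t H)` is the explicit `t`-derivative of the polynomial `t H`.
  have hHt : HasDerivAt (fun s => H s * (s : ℂ)) (p t * q t + θ1) t := by
    have hpoly : (fun s => H s * (s : ℂ)) =ᶠ[nhds t] fun s =>
        p s ^ 2 * ((q s - 1) ^ 2 * q s)
          + p s * (q s ^ 2 * (θ0 + 3 * θ1 + θinf)
            + q s * ((s : ℂ) - 2 * θinf - 4 * θ1) + (θinf + θ1 - θ0))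
          + q s * (2 * θ1 * (θinf + θ1 + θ0))
          + ((s : ℂ) * θ1 + (θ0 ^ 2 - θ1 ^ 2 - θinf ^ 2 - 2 * θ1 * θinf)) := by
      filter_upwards [hIo.mem_nhds ht] with s hs
      have hs0 : (s : ℂ) ≠ 0 := by
        exact_mod_cast fun h : s = 0 => h0 (h ▸ hs)
      rw [hH s]
      field_simp
      ring
    refine HasDerivAt.congr_of_eventuallyEq ?_ hpoly
    have hqt := hq t ht
    have hpt := hp t ht
    refine HasDerivAt.congr_deriv
      (((((hpt.fun_pow 2).fun_mul (((hqt.sub_const 1).fun_pow 2).fun_mul hqt)).fun_add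
        (hpt.fun_mul ((((hqt.fun_pow 2).mul_const (θ0 + 3 * θ1 + θinf)).fun_add
          (hqt.fun_mul ((hcast.sub_const (2 * θinf)).sub_const (4 * θ1)))).add_const
            (θinf + θ1 - θ0)))).fun_add
        (hqt.mul_const (2 * θ1 * (θinf + θ1 + θ0)))).fun_add
        ((hcast.mul_const θ1).add_const
          (θ0 ^ 2 - θ1 ^ 2 - θinf ^ 2 - 2 * θ1 * θinf))) ?_
    simp only [Nat.add_one_sub_one, pow_one, Nat.cast_ofNat]
    field_simp
    ring
  rw [hHt.deriv, (hq t ht).deriv, (hk t ht).deriv, (ha t ht).deriv, (hb t ht).deriv, hH t]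
  field_simp
  ring
end

section
/- Let I ⊂ ℝ be an open interval with 0 ∉ I and 1 ∉ I, let θ₀, θ₁, θ_t, θ∞ ∈ ℂ be constants, and define H(p,q,t) = p²q(q−1)(q−t)/(t(t−1)) + p q(q−1)/(t(t−1)) + θ∞(1−θ∞)(q−t)/(t(t−1)) + θ₀²(q−t)/(q t(t−1)) − θ₁²(q−t)/((q−1)t(t−1)) + θ_t²(t²−q(2t−1))/((q−t)t(t−1)). Then differentiable functions q, p : I → ℂ with q(t) ≠ 0, q(t) ≠ 1, q(t) ≠ t on I satisfy the Painlevé VI system q' = 2pq(q−1)(q−t)/(t(t−1)) + q(q−1)/(t(t−1)) and p' = (1/(4t(t−1)))(4p²(2tq−3q²−t+2q) + 4p(1−2q) + 4θ∞(θ∞−1)) − θ₀²/(q²(t−1)) + θ₁²/(t(q−1)²) − θ_t²/(q−t)² on I if and only if they satisfy Hamilton's equations q'(t) = (∂H/∂p)(p(t),q(t),t) and p'(t) = −(∂H/∂q)(p(t),q(t),t) on I. -/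
/-- The Painlevé VI Hamiltonian, with a complex time variable. -/
noncomputable def painleveVIHamiltonian (θ0 θ1 θt θinf P Q t : ℂ) : ℂ :=
  P ^ 2 * Q * (Q - 1) * (Q - t) / (t * (t - 1))
    + P * Q * (Q - 1) / (t * (t - 1))
    + θinf * (1 - θinf) * (Q - t) / (t * (t - 1))
    + θ0 ^ 2 * (Q - t) / (Q * t * (t - 1))
    - θ1 ^ 2 * (Q - t) / ((Q - 1) * t * (t - 1))
    + θt ^ 2 * (t ^ 2 - Q * (2 * t - 1)) / ((Q - t) * t * (t - 1))

theorem hasDerivAt_painleveVIHamiltonian_momentum (θ0 θ1 θt θinf P Q t : ℂ) :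
    HasDerivAt (fun P => painleveVIHamiltonian θ0 θ1 θt θinf P Q t)
      (2 * P * Q * (Q - 1) * (Q - t) / (t * (t - 1)) + Q * (Q - 1) / (t * (t - 1))) P := by
  have hP := hasDerivAt_id' P
  have hsq := ((((hP.pow 2).mul_const Q).mul_const (Q - 1)).mul_const (Q - t)).div_const
    (t * (t - 1))
  have hlin := ((hP.mul_const Q).mul_const (Q - 1)).div_const (t * (t - 1))
  refine (((((hsq.add hlin).add_const _).add_const _).sub_const _).add_const _).congr_deriv ?_
  simp

theorem hasDerivAt_painleveVIHamiltonian_position (θ0 θ1 θt θinf P : ℂ) {Q t : ℂ}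
    (ht0 : t ≠ 0) (ht1 : t ≠ 1) (hQ0 : Q ≠ 0) (hQ1 : Q ≠ 1) (hQt : Q ≠ t) :
    HasDerivAt (fun Q => painleveVIHamiltonian θ0 θ1 θt θinf P Q t)
      (-((1 / (4 * t * (t - 1))) *
          (4 * P ^ 2 * (2 * t * Q - 3 * Q ^ 2 - t + 2 * Q)
            + 4 * P * (1 - 2 * Q) + 4 * θinf * (θinf - 1))
        - θ0 ^ 2 / (Q ^ 2 * (t - 1))
        + θ1 ^ 2 / (t * (Q - 1) ^ 2)
        - θt ^ 2 / (Q - t) ^ 2)) Q := by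
  have ht1' : t - 1 ≠ 0 := sub_ne_zero.mpr ht1
  have hQ1' : Q - 1 ≠ 0 := sub_ne_zero.mpr hQ1
  have hQt' : Q - t ≠ 0 := sub_ne_zero.mpr hQt
  have hQ := hasDerivAt_id' Q
  have hsq := (((hQ.const_mul (P ^ 2)).mul (hQ.sub_const 1)).mul (hQ.sub_const t)).div_const
    (t * (t - 1))
  have hlin := ((hQ.const_mul P).mul (hQ.sub_const 1)).div_const (t * (t - 1))
  have hinf := ((hQ.sub_const t).const_mul (θinf * (1 - θinf))).div_const (t * (t - 1))
  have hzero := ((hQ.sub_const t).const_mul (θ0 ^ 2)).div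
    ((hQ.mul_const t).mul_const (t - 1)) (mul_ne_zero (mul_ne_zero hQ0 ht0) ht1')
  have hone := ((hQ.sub_const t).const_mul (θ1 ^ 2)).div
    (((hQ.sub_const 1).mul_const t).mul_const (t - 1)) (mul_ne_zero (mul_ne_zero hQ1' ht0) ht1')
  have htime := (((hQ.mul_const (2 * t - 1)).const_sub (t ^ 2)).const_mul (θt ^ 2)).div
    (((hQ.sub_const t).mul_const t).mul_const (t - 1)) (mul_ne_zero (mul_ne_zero hQt' ht0) ht1')
  refine (((((hsq.add hlin).add hinf).add hzero).sub hone).add htime).congr_deriv ?_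
  simp only [Pi.mul_apply]
  field_simp
  ring

/-- the Painlevé VI system is equivalent to Hamilton's equations for the
Painlevé VI Hamiltonian. -/
theorem painleveVI_hamiltonian_iff
    (I : Set ℝ) (hIo : IsOpen I) (hIc : I.OrdConnected)
    (h0 : (0 : ℝ) ∉ I) (h1 : (1 : ℝ) ∉ I)
    (θ0 θ1 θt θinf : ℂ)
    (H : ℂ → ℂ → ℝ → ℂ)
    (hH : ∀ (P Q : ℂ) (t : ℝ),
      H P Q t = P ^ 2 * Q * (Q - 1) * (Q - (t : ℂ)) / ((t : ℂ) * ((t : ℂ) - 1))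
        + P * Q * (Q - 1) / ((t : ℂ) * ((t : ℂ) - 1))
        + θinf * (1 - θinf) * (Q - (t : ℂ)) / ((t : ℂ) * ((t : ℂ) - 1))
        + θ0 ^ 2 * (Q - (t : ℂ)) / (Q * (t : ℂ) * ((t : ℂ) - 1))
        - θ1 ^ 2 * (Q - (t : ℂ)) / ((Q - 1) * (t : ℂ) * ((t : ℂ) - 1))
        + θt ^ 2 * ((t : ℂ) ^ 2 - Q * (2 * (t : ℂ) - 1))
            / ((Q - (t : ℂ)) * (t : ℂ) * ((t : ℂ) - 1)))
    (q p : ℝ → ℂ)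
    (hq0 : ∀ t ∈ I, q t ≠ 0) (hq1 : ∀ t ∈ I, q t ≠ 1)
    (hqt : ∀ t ∈ I, q t ≠ (t : ℂ))
    (hqd : ∀ t ∈ I, DifferentiableAt ℝ q t)
    (hpd : ∀ t ∈ I, DifferentiableAt ℝ p t) :
    (∀ t ∈ I,
        HasDerivAt q
          (2 * p t * q t * (q t - 1) * (q t - (t : ℂ)) / ((t : ℂ) * ((t : ℂ) - 1))
            + q t * (q t - 1) / ((t : ℂ) * ((t : ℂ) - 1))) t ∧
        HasDerivAt p
          ((1 / (4 * (t : ℂ) * ((t : ℂ) - 1))) *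
              (4 * (p t) ^ 2 * (2 * (t : ℂ) * q t - 3 * (q t) ^ 2 - (t : ℂ) + 2 * q t)
                + 4 * p t * (1 - 2 * q t) + 4 * θinf * (θinf - 1))
            - θ0 ^ 2 / ((q t) ^ 2 * ((t : ℂ) - 1))
            + θ1 ^ 2 / ((t : ℂ) * (q t - 1) ^ 2)
            - θt ^ 2 / (q t - (t : ℂ)) ^ 2) t) ↔
    (∀ t ∈ I,
        HasDerivAt q (deriv (fun P => H P (q t) t) (p t)) t ∧
        HasDerivAt p (-(deriv (fun Q => H (p t) Q t) (q t))) t) := by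
  have hH' (P Q : ℂ) (t : ℝ) : H P Q t = painleveVIHamiltonian θ0 θ1 θt θinf P Q t := hH P Q t
  refine forall₂_congr fun t ht => ?_
  have ht0 : (t : ℂ) ≠ 0 := Complex.ofReal_ne_zero.mpr (ne_of_mem_of_not_mem ht h0)
  have ht1 : (t : ℂ) ≠ 1 := Complex.ofReal_ne_one.mpr (ne_of_mem_of_not_mem ht h1)
  simp only [hH']
  rw [(hasDerivAt_painleveVIHamiltonian_momentum θ0 θ1 θt θinf (p t) (q t) t).deriv,
    (hasDerivAt_painleveVIHamiltonian_position θ0 θ1 θt θinf (p t) ht0 ht1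
      (hq0 t ht) (hq1 t ht) (hqt t ht)).deriv, neg_neg]
end

section
/- Let I ⊂ ℝ be an open interval with 0 ∉ I and 1 ∉ I, let θ₀, θ₁, θ_t, θ∞ ∈ ℂ be constants, and let q, p, k, a, b, c : I → ℂ be differentiable with q(t) ≠ 0, q(t) ≠ 1, q(t) ≠ t, and k(t), a(t), b(t), c(t) ≠ 0 on I, satisfying the Painlevé VI system q' = 2pq(q−1)(q−t)/(t(t−1)) + q(q−1)/(t(t−1)), p' = (1/(4t(t−1)))(4p²(2tq−3q²−t+2q) + 4p(1−2q) + 4θ∞(θ∞−1)) − θ₀²/(q²(t−1)) + θ₁²/(t(q−1)²) − θ_t²/(q−t)², together with k' = k(2θ∞−1)(q−t)/(t(t−1)), a' = −2θ₀(q−t)a/(q t(t−1)), b' = 2θ₁(q−t)b/(t(t−1)(q−1)), c' = 2θ_t(q(2t−1)−t²)c/((q−t)t(t−1)) on I. Define H(t) = p(t)²q(t)(q(t)−1)(q(t)−t)/(t(t−1)) + p(t)q(t)(q(t)−1)/(t(t−1)) + θ∞(1−θ∞)(q(t)−t)/(t(t−1)) + θ₀²(q(t)−t)/(q(t)t(t−1))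 − θ₁²(q(t)−t)/((q(t)−1)t(t−1)) + θ_t²(t²−q(t)(2t−1))/((q(t)−t)t(t−1)). Then for all t ∈ I, H(t) − p(t)q(t)(q(t)−1)/(t(t−1)) − θ∞(q(t)−t)/(t(t−1)) = p(t) q'(t) − H(t) − θ₀ a'(t)/a(t) − θ₁ b'(t)/b(t) − θ_t c'(t)/c(t) − θ∞ k'(t)/k(t). -/
/-- along solutions of the Painlevé VI system (with gauge functions
`k`, `a`, `b`, `c`), the Jimbo–Miwa–Ueno logarithmic derivative
`H − pq(q−1)/(t(t−1)) − θ∞(q−t)/(t(t−1))` equals the classical action density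
`p q' − H − θ₀ a'/a − θ₁ b'/b − θ_t c'/c − θ∞ k'/k`. -/
theorem painleveVI_action_identity
    (I : Set ℝ) (hIo : IsOpen I) (hIc : I.OrdConnected)
    (h0 : (0 : ℝ) ∉ I) (h1 : (1 : ℝ) ∉ I)
    (θ0 θ1 θt θinf : ℂ) (q p k a b c : ℝ → ℂ)
    (hq0 : ∀ t ∈ I, q t ≠ 0) (hq1 : ∀ t ∈ I, q t ≠ 1)
    (hqt : ∀ t ∈ I, q t ≠ (t : ℂ))
    (hk0 : ∀ t ∈ I, k t ≠ 0) (ha0 : ∀ t ∈ I, a t ≠ 0)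
    (hb0 : ∀ t ∈ I, b t ≠ 0) (hc0 : ∀ t ∈ I, c t ≠ 0)
    (hq : ∀ t ∈ I, HasDerivAt q
      (2 * p t * q t * (q t - 1) * (q t - (t : ℂ)) / ((t : ℂ) * ((t : ℂ) - 1))
        + q t * (q t - 1) / ((t : ℂ) * ((t : ℂ) - 1))) t)
    (hp : ∀ t ∈ I, HasDerivAt p
      ((1 / (4 * (t : ℂ) * ((t : ℂ) - 1))) *
          (4 * (p t) ^ 2 * (2 * (t : ℂ) * q t - 3 * (q t) ^ 2 - (t : ℂ) + 2 * q t)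
            + 4 * p t * (1 - 2 * q t) + 4 * θinf * (θinf - 1))
        - θ0 ^ 2 / ((q t) ^ 2 * ((t : ℂ) - 1))
        + θ1 ^ 2 / ((t : ℂ) * (q t - 1) ^ 2)
        - θt ^ 2 / (q t - (t : ℂ)) ^ 2) t)
    (hk : ∀ t ∈ I, HasDerivAt k
      (k t * (2 * θinf - 1) * (q t - (t : ℂ)) / ((t : ℂ) * ((t : ℂ) - 1))) t)
    (ha : ∀ t ∈ I, HasDerivAt a
      (-2 * θ0 * (q t - (t : ℂ)) * a t / (q t * (t : ℂ) * ((t : ℂ) - 1))) t)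
    (hb : ∀ t ∈ I, HasDerivAt b
      (2 * θ1 * (q t - (t : ℂ)) * b t / ((t : ℂ) * ((t : ℂ) - 1) * (q t - 1))) t)
    (hc : ∀ t ∈ I, HasDerivAt c
      (2 * θt * (q t * (2 * (t : ℂ) - 1) - (t : ℂ) ^ 2) * c t
        / ((q t - (t : ℂ)) * (t : ℂ) * ((t : ℂ) - 1))) t)
    (H : ℝ → ℂ)
    (hH : ∀ t : ℝ,
      H t = (p t) ^ 2 * q t * (q t - 1) * (q t - (t : ℂ)) / ((t : ℂ) * ((t : ℂ) - 1))
        + p t * q t * (q t - 1) / ((t : ℂ) * ((t : ℂ) - 1))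
        + θinf * (1 - θinf) * (q t - (t : ℂ)) / ((t : ℂ) * ((t : ℂ) - 1))
        + θ0 ^ 2 * (q t - (t : ℂ)) / (q t * (t : ℂ) * ((t : ℂ) - 1))
        - θ1 ^ 2 * (q t - (t : ℂ)) / ((q t - 1) * (t : ℂ) * ((t : ℂ) - 1))
        + θt ^ 2 * ((t : ℂ) ^ 2 - q t * (2 * (t : ℂ) - 1))
            / ((q t - (t : ℂ)) * (t : ℂ) * ((t : ℂ) - 1))) :
    ∀ t ∈ I,
      H t - p t * q t * (q t - 1) / ((t : ℂ) * ((t : ℂ) - 1))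
          - θinf * (q t - (t : ℂ)) / ((t : ℂ) * ((t : ℂ) - 1))
        = p t * deriv q t - H t
          - θ0 * deriv a t / a t - θ1 * deriv b t / b t
          - θt * deriv c t / c t - θinf * deriv k t / k t := by
  intro t ht
  have hk' := hk0 t ht
  have ha' := ha0 t ht
  have hb' := hb0 t ht
  have hc' := hc0 t ht
  have hq0' := hq0 t ht
  have hq1' : q t - 1 ≠ 0 := sub_ne_zero.mpr (hq1 t ht)
  have hqt' : q t - (t : ℂ) ≠ 0 := sub_ne_zero.mpr (hqt t ht)
  have ht0 : (t : ℂ) ≠ 0 := by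
    exact_mod_cast fun h : t = 0 => h0 (h ▸ ht)
  have ht1 : (t : ℂ) - 1 ≠ 0 :=
    sub_ne_zero.mpr (by exact_mod_cast fun h : t = 1 => h1 (h ▸ ht))
  rw [(hq t ht).deriv, (ha t ht).deriv, (hb t ht).deriv, (hc t ht).deriv, (hk t ht).deriv, hH t]
  field_simp
  ring
end

section
/- Let N ≥ 1, n ≥ 2, and let U ⊂ ℂⁿ be an open set on which all coordinates a₁, …, a_n are pairwise distinct. For ν = 1, …, n let Θ_ν be a constant N×N complex matrix and let G_ν : U → GL_N(ℂ) be differentiable; set A_ν(a) = G_ν(a) Θ_ν G_ν(a)⁻¹. Suppose that for all μ ≠ ν, ∂G_μ/∂a_ν = (A_ν/(a_ν − a_μ)) G_μ, and that for each ν, ∂G_ν/∂a_ν = −Σ_{μ≠ν} (A_μ/(a_μ − a_ν)) G_ν on U. Then the matrices A_ν satisfy the Schlesinger system on U: for all μ ≠ ν, ∂A_μ/∂a_ν = [A_μ, A_ν]/(a_μ − a_ν), and for each ν, ∂A_ν/∂a_ν = −Σ_{μ≠ν} [A_μ, A_ν]/(a_μ − a_ν), where [X,Y] = XY − YX. -/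
section Conjugation

attribute [local instance] Matrix.linftyOpNormedRing Matrix.linftyOpNormedAlgebra

/-- The derivative of `G Θ G⁻¹` when `G' = B G`, for the operator norm on matrices. -/
lemma hasDerivAt_conj_linftyOp {m : Type*} [Fintype m] [DecidableEq m]
    {G : ℂ → Matrix m m ℂ} {B Θ : Matrix m m ℂ} {z : ℂ}
    (hunit : IsUnit (G z)) (hG : HasDerivAt G (B * G z) z) :
    HasDerivAt (fun w => G w * Θ * (G w)⁻¹)
      (B * (G z * Θ * (G z)⁻¹) - G z * Θ * (G z)⁻¹ * B) z := by
  obtain ⟨u, hu⟩ := hunit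
  have hinv : HasDerivAt (fun w => (G w)⁻¹) (-((G z)⁻¹ * B)) z := by
    have h := hasFDerivAt_ringInverse (𝕜 := ℂ) u
    rw [hu] at h
    have h' := h.comp_hasDerivAt z hG
    have huinv : (↑u⁻¹ : Matrix m m ℂ) = (G z)⁻¹ := by rw [← hu, Matrix.coe_units_inv]
    have hcancel : G z * (G z)⁻¹ = 1 := by rw [← huinv, ← hu, Units.mul_inv]
    have heq : (fun w => (G w)⁻¹) = Ring.inverse ∘ G :=
      funext fun w => Matrix.nonsing_inv_eq_ringInverse _
    rw [heq]
    refine h'.congr_deriv ?_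
    simp [huinv, mul_assoc, hcancel]
  refine ((hG.mul_const Θ).mul hinv).congr_deriv ?_
  simp only [mul_neg, mul_assoc, sub_eq_add_neg]

end Conjugation

attribute [local instance] Matrix.normedAddCommGroup Matrix.normedSpace

/-- The derivative of `G Θ G⁻¹` when `G' = B G`, for the entrywise sup norm on matrices. -/
lemma hasDerivAt_conj {m : Type*} [Fintype m] [DecidableEq m]
    {G : ℂ → Matrix m m ℂ} {B Θ : Matrix m m ℂ} {z : ℂ}
    (hunit : IsUnit (G z)) (hG : HasDerivAt G (B * G z) z) :
    HasDerivAt (fun w => G w * Θ * (G w)⁻¹)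
      (B * (G z * Θ * (G z)⁻¹) - G z * Θ * (G z)⁻¹ * B) z :=
  hasDerivAt_conj_linftyOp hunit hG

/-- if the gauge matrices `G_ν` satisfy the isomonodromic deformation
equations `∂G_μ/∂a_ν = A_ν G_μ/(a_ν − a_μ)` (`μ ≠ ν`) and
`∂G_ν/∂a_ν = −Σ_{μ≠ν} A_μ G_ν/(a_μ − a_ν)`, where `A_ν = G_ν Θ_ν G_ν⁻¹` with
constant `Θ_ν`, then the `A_ν` satisfy the Schlesinger system. -/
theorem schlesinger_system
    (N n : ℕ) (hN : 1 ≤ N) (hn : 2 ≤ n)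
    (U : Set (Fin n → ℂ)) (hU : IsOpen U)
    (hdist : ∀ a ∈ U, ∀ μ ν : Fin n, μ ≠ ν → a μ ≠ a ν)
    (Θ : Fin n → Matrix (Fin N) (Fin N) ℂ)
    (G : Fin n → (Fin n → ℂ) → Matrix (Fin N) (Fin N) ℂ)
    (hGunit : ∀ ν : Fin n, ∀ a ∈ U, IsUnit (G ν a))
    (A : Fin n → (Fin n → ℂ) → Matrix (Fin N) (Fin N) ℂ)
    (hA : ∀ (ν : Fin n) (a : Fin n → ℂ), A ν a = G ν a * Θ ν * (G ν a)⁻¹)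
    (hG1 : ∀ a ∈ U, ∀ μ ν : Fin n, μ ≠ ν →
      HasDerivAt (fun z => G μ (Function.update a ν z))
        ((a ν - a μ)⁻¹ • (A ν a * G μ a)) (a ν))
    (hG2 : ∀ a ∈ U, ∀ ν : Fin n,
      HasDerivAt (fun z => G ν (Function.update a ν z))
        (-(∑ μ ∈ Finset.univ.erase ν, (a μ - a ν)⁻¹ • (A μ a * G ν a))) (a ν)) :
    (∀ a ∈ U, ∀ μ ν : Fin n, μ ≠ ν →
      HasDerivAt (fun z => A μ (Function.update a ν z))
        ((a μ - a ν)⁻¹ • (A μ a * A ν a - A ν a * A μ a)) (a ν)) ∧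
    (∀ a ∈ U, ∀ ν : Fin n,
      HasDerivAt (fun z => A ν (Function.update a ν z))
        (-(∑ μ ∈ Finset.univ.erase ν,
            (a μ - a ν)⁻¹ • (A μ a * A ν a - A ν a * A μ a))) (a ν)) := by
  have key : ∀ a ∈ U, ∀ (μ ν : Fin n) (B : Matrix (Fin N) (Fin N) ℂ),
      HasDerivAt (fun z => G μ (Function.update a ν z)) (B * G μ a) (a ν) →
      HasDerivAt (fun z => A μ (Function.update a ν z)) (B * A μ a - A μ a * B) (a ν) := by
    intro a ha μ ν B h
    simp only [hA]
    have := hasDerivAt_conj (G := fun z => G μ (Function.update a ν z)) (B := B) (Θ := Θ μ)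
      (z := a ν) (by simpa using hGunit μ a ha) (by simpa using h)
    simpa using this
  refine ⟨fun a ha μ ν hne => ?_, fun a ha ν => ?_⟩
  · convert key a ha μ ν ((a ν - a μ)⁻¹ • A ν a) (by simpa using hG1 a ha μ ν hne) using 1
    rw [← neg_sub (a ν) (a μ), inv_neg, neg_smul, ← smul_neg, neg_sub]
    simp [smul_sub]
  · convert key a ha ν ν (-∑ μ ∈ Finset.univ.erase ν, (a μ - a ν)⁻¹ • A μ a)
      (by simpa only [neg_mul, Finset.sum_mul, smul_mul_assoc] using hG2 a ha ν) using 1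
    simp only [neg_mul, mul_neg, Finset.sum_mul, Finset.mul_sum, smul_mul_assoc, mul_smul_comm,
      smul_sub, Finset.sum_sub_distrib]
    abel
end

section
/- Let n ≥ 1, let t₁ < t₂ be reals, let J ⊂ ℝ be an open interval (the parameter interval), and let H : ℝⁿ × ℝⁿ × ℝ → ℝ be continuously differentiable. Let p, q : J × [t₁, t₂] → ℝⁿ be continuously differentiable in (m, t), with q additionally having continuous mixed second partial derivative ∂²q/∂t∂m, and suppose that for each m ∈ J Hamilton's equations hold: ∂q/∂t(m,t) = (∂H/∂p)(p(m,t), q(m,t), t) and ∂p/∂t(m,t) = −(∂H/∂q)(p(m,t), q(m,t), t) for all t ∈ [t₁, t₂]. Define the action S(m) = ∫_{t₁}^{t₂} ( ⟨p(m,t), ∂q/∂t(m,t)⟩ − H(p(m,t), q(m,t), t) ) dt, where ⟨·,·⟩ is the Euclidean inner product on ℝⁿ. Then S is differentiable on J and S'(m) = ⟨p(m,t₂), ∂q/∂m(m,t₂)⟩ − ⟨p(m,t₁), ∂q/∂m(m,t₁)⟩. -/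
open Set

open Filter Topology

/-- The pairing of a continuous family of linear maps with a differentiable curve vanishing at `m`
is differentiable at `m`, even when the family is not. -/
lemma hasDerivAt_clm_apply_of_eq_zero {V W : Type*} [NormedAddCommGroup V] [NormedSpace ℝ V]
    [NormedAddCommGroup W] [NormedSpace ℝ W] {L : ℝ → V →L[ℝ] W} {g : ℝ → V} {g' : V} {m : ℝ}
    (hL : ContinuousAt L m) (hg : HasDerivAt g g' m) (h0 : g m = 0) :
    HasDerivAt (fun x => L x (g x)) (L m g') m := by
  rw [hasDerivAt_iff_tendsto_slope] at hg ⊢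
  refine ((isBoundedBilinearMap_apply.continuous.tendsto (L m, g')).comp
    ((hL.tendsto.mono_left nhdsWithin_le_nhds).prodMk_nhds hg)).congr fun x => ?_
  simp [slope_def_module, h0]

/-- If `F m` vanishes, each `F · t` has derivative zero at `m`, and `F · t` is Lipschitz at `m`
uniformly in `t`, then the integral of `F` has derivative zero at `m`. -/
lemma hasDerivAt_intervalIntegral_zero {F : ℝ → ℝ → ℝ} {a b m C : ℝ} (hab : a ≤ b)
    (hcont : ∀ᶠ x in 𝓝 m, ContinuousOn (F x) (Icc a b))
    (h0 : ∀ t, F m t = 0)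
    (hbound : ∀ᶠ x in 𝓝 m, ∀ t ∈ Icc a b, ‖F x t‖ ≤ C * ‖x - m‖)
    (hderiv : ∀ t ∈ Icc a b, HasDerivAt (fun x => F x t) 0 m) :
    HasDerivAt (fun x => ∫ t in a..b, F x t) 0 m := by
  have hsub : uIoc a b ⊆ Icc a b := by
    rw [uIoc_of_le hab]; exact Ioc_subset_Icc_self
  rw [hasDerivAt_iff_tendsto_slope]
  have key : Tendsto (fun x => ∫ t in a..b, (x - m)⁻¹ * F x t) (𝓝[≠] m)
      (𝓝 (∫ _ in a..b, (0 : ℝ))) := by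
    refine intervalIntegral.tendsto_integral_filter_of_dominated_convergence (fun _ => C) ?_ ?_ ?_ ?_
    · filter_upwards [nhdsWithin_le_nhds hcont] with x hx
      exact ((continuousOn_const.mul hx).mono hsub).aestronglyMeasurable measurableSet_uIoc
    · filter_upwards [nhdsWithin_le_nhds hbound, self_mem_nhdsWithin] with x hx hne
      refine Eventually.of_forall fun t ht => ?_
      have hpos : 0 < ‖x - m‖ := norm_pos_iff.2 (sub_ne_zero.2 hne)
      rw [norm_mul, norm_inv, inv_mul_le_iff₀ hpos, mul_comm]
      exact hx t (hsub ht)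
    · exact intervalIntegrable_const
    · refine Eventually.of_forall fun t ht => ?_
      have h := hasDerivAt_iff_tendsto_slope.1 (hderiv t (hsub ht))
      refine h.congr fun x => ?_
      simp [slope_def_module, h0]
  rw [intervalIntegral.integral_zero] at key
  refine key.congr fun x => ?_
  simp [slope_def_module, h0]

/-- A `C¹` function on the product of an open set with an interval is Lipschitz in the first
variable, locally uniformly in both. -/
lemma exists_eventually_norm_sub_le {V : Type*} [NormedAddCommGroup V] [NormedSpace ℝ V]
    {J : Set ℝ} (hJ : IsOpen J) {a b m : ℝ} (hm : m ∈ J) {f : ℝ × ℝ → V}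
    (hf : ContDiffOn ℝ 1 f (J ×ˢ Icc a b)) :
    ∃ C : ℝ, ∀ᶠ x in 𝓝 m, ∀ t ∈ Icc a b, ‖f (x, t) - f (m, t)‖ ≤ C * ‖x - m‖ := by
  obtain ⟨δ, hδ, hball⟩ := Metric.nhds_basis_closedBall.mem_iff.1 (hJ.mem_nhds hm)
  obtain ⟨K, hK⟩ := (hf.mono (prod_mono_left hball)).exists_lipschitzOnWith one_ne_zero
    ((convex_closedBall m δ).prod (convex_Icc a b)) ((isCompact_closedBall m δ).prod isCompact_Icc)
  refine ⟨K, ?_⟩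
  filter_upwards [Metric.closedBall_mem_nhds m hδ] with x hx t ht
  have h := hK.norm_sub_le (x := (x, t)) ⟨hx, ht⟩ (y := (m, t))
    ⟨Metric.mem_closedBall_self hδ.le, ht⟩
  simpa [Prod.norm_def] using h

/-- A continuous function on the product of an open set with a compact interval is bounded,
locally uniformly in the first variable. -/
lemma exists_eventually_norm_le {V : Type*} [NormedAddCommGroup V]
    {J : Set ℝ} (hJ : IsOpen J) {a b m : ℝ} (hm : m ∈ J) {f : ℝ × ℝ → V}
    (hf : ContinuousOn f (J ×ˢ Icc a b)) :
    ∃ C : ℝ, ∀ᶠ x in 𝓝 m, ∀ t ∈ Icc a b, ‖f (x, t)‖ ≤ C := by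
  obtain ⟨δ, hδ, hball⟩ := Metric.nhds_basis_closedBall.mem_iff.1 (hJ.mem_nhds hm)
  obtain ⟨C, hC⟩ := ((isCompact_closedBall m δ).prod isCompact_Icc).exists_bound_of_continuousOn
    (hf.mono (prod_mono_left hball))
  refine ⟨C, ?_⟩
  filter_upwards [Metric.closedBall_mem_nhds m hδ] with x hx t ht
  exact hC _ ⟨hx, ht⟩

lemma continuousOn_section_right {V : Type*} [TopologicalSpace V] {J T : Set ℝ} {f : ℝ × ℝ → V}
    (hf : ContinuousOn f (J ×ˢ T)) {m : ℝ} (hm : m ∈ J) : ContinuousOn (fun t => f (m, t)) T :=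
  hf.comp (by fun_prop) fun _ ht => ⟨hm, ht⟩

lemma continuousAt_section_left {V : Type*} [TopologicalSpace V] {J T : Set ℝ} (hJ : IsOpen J)
    {f : ℝ × ℝ → V} (hf : ContinuousOn f (J ×ˢ T)) {m t : ℝ} (hm : m ∈ J) (ht : t ∈ T) :
    ContinuousAt (fun x => f (x, t)) m :=
  (hf.comp (f := fun x => (x, t)) (by fun_prop) fun _ hx => ⟨hx, ht⟩).continuousAt
    (hJ.mem_nhds hm)

lemma differentiableAt_section_left {V : Type*} [NormedAddCommGroup V] [NormedSpace ℝ V]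
    {J T : Set ℝ} (hJ : IsOpen J) {f : ℝ × ℝ → V} (hf : ContDiffOn ℝ 1 f (J ×ˢ T)) {m t : ℝ}
    (hm : m ∈ J) (ht : t ∈ T) : DifferentiableAt ℝ (fun x => f (x, t)) m :=
  ((hf.differentiableOn one_ne_zero).comp (f := fun x => (x, t)) (by fun_prop)
    fun _ hx => ⟨hx, ht⟩).differentiableAt (hJ.mem_nhds hm)

/-- A linear map on a finite power of `ℝ` is the sum of its values on the coordinate vectors. -/
lemma clm_pi_apply_eq_sum {n : ℕ} (L : (Fin n → ℝ) →L[ℝ] ℝ) (u : Fin n → ℝ) :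
    L u = ∑ i, L (Pi.single i 1) * u i := by
  conv_lhs => rw [pi_eq_sum_univ' u, map_sum]
  refine Finset.sum_congr rfl fun i _ => ?_
  simp [mul_comm]

/-- First variation of the action relative to the member `m`: after integrating `⟨p, ∂q/∂t⟩` by
parts, the remaining integrand is `∂H/∂q` at `x` applied to the increment of `q`, plus `∂H/∂p` at
`m` applied to the increment of `p`, minus the increment of `H`. Here `Φ` is the Hamiltonian. -/
noncomputable def actionRemainder {V : Type*} [NormedAddCommGroup V] [NormedSpace ℝ V]
    (Φ : V × V × ℝ → ℝ) (p q : ℝ → ℝ → V) (m x t : ℝ) : ℝ :=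
  fderiv ℝ Φ (p x t, q x t, t) (0, q x t - q m t, 0)
    + fderiv ℝ Φ (p m t, q m t, t) (p x t - p m t, 0, 0)
    - (Φ (p x t, q x t, t) - Φ (p m t, q m t, t))

lemma hasDerivAt_integral_actionRemainder {V : Type*} [NormedAddCommGroup V] [NormedSpace ℝ V]
    {Φ : V × V × ℝ → ℝ} (hΦ : ContDiff ℝ 1 Φ) {p q : ℝ → ℝ → V} {J : Set ℝ} (hJ : IsOpen J)
    {a b : ℝ} (hab : a ≤ b)
    (hp : ContDiffOn ℝ 1 (fun z : ℝ × ℝ => p z.1 z.2) (J ×ˢ Icc a b))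
    (hq : ContDiffOn ℝ 1 (fun z : ℝ × ℝ => q z.1 z.2) (J ×ˢ Icc a b)) {m : ℝ} (hm : m ∈ J) :
    HasDerivAt (fun x => ∫ t in a..b, actionRemainder Φ p q m x t) 0 m := by
  have hγ : ContDiffOn ℝ 1 (fun z : ℝ × ℝ => (p z.1 z.2, q z.1 z.2, z.2)) (J ×ˢ Icc a b) :=
    hp.prodMk (hq.prodMk contDiffOn_snd)
  have hΦγ := hΦ.comp_contDiffOn hγ
  have hD : ContinuousOn (fun z : ℝ × ℝ => fderiv ℝ Φ (p z.1 z.2, q z.1 z.2, z.2))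
      (J ×ˢ Icc a b) := (hΦ.continuous_fderiv one_ne_zero).comp_continuousOn hγ.continuousOn
  obtain ⟨M, hM⟩ := exists_eventually_norm_le hJ hm hD
  obtain ⟨Cp, hCp⟩ := exists_eventually_norm_sub_le hJ hm hp
  obtain ⟨Cq, hCq⟩ := exists_eventually_norm_sub_le hJ hm hq
  obtain ⟨CH, hCH⟩ := exists_eventually_norm_sub_le hJ hm hΦγ
  refine hasDerivAt_intervalIntegral_zero (C := M * Cq + M * Cp + CH) hab ?_ ?_ ?_ ?_
  · filter_upwards [hJ.mem_nhds hm] with x hx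
    have hpx := continuousOn_section_right hp.continuousOn hx
    have hqx := continuousOn_section_right hq.continuousOn hx
    have hpm := continuousOn_section_right hp.continuousOn hm
    have hqm := continuousOn_section_right hq.continuousOn hm
    refine ContinuousOn.sub (ContinuousOn.add ?_ ?_) (ContinuousOn.sub ?_ ?_)
    · exact (continuousOn_section_right hD hx).clm_apply
        (continuousOn_const.prodMk ((hqx.sub hqm).prodMk continuousOn_const))
    · exact (continuousOn_section_right hD hm).clm_apply
        ((hpx.sub hpm).prodMk continuousOn_const)
    · exact continuousOn_section_right hΦγ.continuousOn hx
    · exact continuousOn_section_right hΦγ.continuousOn hm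
  · intro t
    have h0 : ((0 : V), (0 : V), (0 : ℝ)) = 0 := rfl
    simp [actionRemainder, h0]
  · filter_upwards [hM, hCp, hCq, hCH] with x hMx hpx hqx hHx t ht
    have hMm := hM.self_of_nhds t ht
    have hM0 : 0 ≤ M := (norm_nonneg _).trans hMm
    have e1 : ‖fderiv ℝ Φ (p x t, q x t, t) (0, q x t - q m t, 0)‖ ≤ M * (Cq * ‖x - m‖) :=
      ContinuousLinearMap.le_of_opNorm_le_of_le _ (hMx t ht)
        (by simpa [Prod.norm_def] using hqx t ht)
    have e2 : ‖fderiv ℝ Φ (p m t, q m t, t) (p x t - p m t, 0, 0)‖ ≤ M * (Cp * ‖x - m‖) :=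
      ContinuousLinearMap.le_of_opNorm_le_of_le _ hMm
        (by simpa [Prod.norm_def] using hpx t ht)
    have e3 : ‖Φ (p x t, q x t, t) - Φ (p m t, q m t, t)‖ ≤ CH * ‖x - m‖ := hHx t ht
    refine (norm_sub_le _ _).trans ?_
    have e4 := norm_add_le (fderiv ℝ Φ (p x t, q x t, t) (0, q x t - q m t, 0))
      (fderiv ℝ Φ (p m t, q m t, t) (p x t - p m t, 0, 0))
    linarith
  · intro t ht
    have hpd := (differentiableAt_section_left hJ hp hm ht).hasDerivAt
    have hqd := (differentiableAt_section_left hJ hq hm ht).hasDerivAt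
    set u := deriv (fun x => p x t) m
    set v := deriv (fun x => q x t) m
    set D := fderiv ℝ Φ (p m t, q m t, t)
    have d1 : HasDerivAt (fun x => fderiv ℝ Φ (p x t, q x t, t) ((0 : V), q x t - q m t, (0 : ℝ)))
        (D (0, v, 0)) m :=
      hasDerivAt_clm_apply_of_eq_zero (continuousAt_section_left hJ hD hm ht)
        ((hasDerivAt_const m (0 : V)).prodMk
          ((hqd.sub_const (q m t)).prodMk (hasDerivAt_const m (0 : ℝ)))) (by simp)
    have d2 : HasDerivAt (fun x => D (p x t - p m t, (0 : V), (0 : ℝ))) (D (u, 0, 0)) m :=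
      D.hasFDerivAt.comp_hasDerivAt m ((hpd.sub_const (p m t)).prodMk
        (hasDerivAt_const m ((0 : V), (0 : ℝ))))
    have d3 : HasDerivAt (fun x => Φ (p x t, q x t, t)) (D (u, v, 0)) m :=
      (hΦ.differentiable one_ne_zero _).hasFDerivAt.comp_hasDerivAt (f := fun x => (p x t, q x t, t))
        m (hpd.prodMk (hqd.prodMk (hasDerivAt_const m t)))
    refine ((d1.add d2).sub (d3.sub_const _)).congr_deriv ?_
    rw [← map_add, ← map_sub]
    simp

/-- for a one-parameter family `(p(m,·), q(m,·))` of solutions of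
Hamilton's equations for a `C¹` Hamiltonian `H(p,q,t)` on `ℝⁿ × ℝⁿ × ℝ`, with
`q` having a continuous mixed second partial `∂²q/∂t∂m = E`, the classical action
`S(m) = ∫_{t₁}^{t₂} (⟨p, ∂q/∂t⟩ − H(p,q,t)) dt` is differentiable in the parameter
`m`, with `S'(m) = ⟨p(m,t₂), ∂q/∂m(m,t₂)⟩ − ⟨p(m,t₁), ∂q/∂m(m,t₁)⟩`. -/
theorem action_parameter_derivative
    (n : ℕ) (hn : 1 ≤ n) (t₁ t₂ : ℝ) (ht : t₁ < t₂)
    (J : Set ℝ) (hJo : IsOpen J) (hJc : J.OrdConnected)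
    (H : (Fin n → ℝ) → (Fin n → ℝ) → ℝ → ℝ)
    (hH : ContDiff ℝ 1 (fun x : (Fin n → ℝ) × (Fin n → ℝ) × ℝ => H x.1 x.2.1 x.2.2))
    (p q : ℝ → ℝ → (Fin n → ℝ))
    (hp : ContDiffOn ℝ 1 (fun z : ℝ × ℝ => p z.1 z.2) (J ×ˢ Icc t₁ t₂))
    (hq : ContDiffOn ℝ 1 (fun z : ℝ × ℝ => q z.1 z.2) (J ×ˢ Icc t₁ t₂))
    (E : ℝ → ℝ → (Fin n → ℝ))
    (hmix : ∀ m ∈ J, ∀ t ∈ Icc t₁ t₂, ∀ i : Fin n,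
      HasDerivAt (fun s => deriv (fun m' => q m' s i) m) (E m t i) t)
    (hEcont : ContinuousOn (fun z : ℝ × ℝ => E z.1 z.2) (J ×ˢ Icc t₁ t₂))
    (hham : ∀ m ∈ J, ∀ t ∈ Icc t₁ t₂, ∀ i : Fin n,
      HasDerivAt (fun s => q m s i)
        (deriv (fun x => H (Function.update (p m t) i x) (q m t) t) (p m t i)) t ∧
      HasDerivAt (fun s => p m s i)
        (-(deriv (fun x => H (p m t) (Function.update (q m t) i x) t) (q m t i))) t)
    (S : ℝ → ℝ)
    (hS : ∀ m : ℝ, S m = ∫ t in t₁..t₂,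
      ((∑ i : Fin n, p m t i * deriv (fun s => q m s i) t) - H (p m t) (q m t) t)) :
    ∀ m ∈ J, HasDerivAt S
      ((∑ i : Fin n, p m t₂ i * deriv (fun m' => q m' t₂ i) m)
        - ∑ i : Fin n, p m t₁ i * deriv (fun m' => q m' t₁ i) m) m := by
  intro m hm
  set Φ : (Fin n → ℝ) × (Fin n → ℝ) × ℝ → ℝ := fun x => H x.1 x.2.1 x.2.2 with hΦ
  let D : ℝ → ℝ → ((Fin n → ℝ) × (Fin n → ℝ) × ℝ →L[ℝ] ℝ) :=
    fun x t => fderiv ℝ Φ (p x t, q x t, t)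
  let A : Fin n → ℝ → ℝ → ℝ := fun i x t => D x t (Pi.single i 1, 0, 0)
  let B : Fin n → ℝ → ℝ → ℝ := fun i x t => D x t (0, Pi.single i 1, 0)
  have hΦd : ∀ z, HasFDerivAt Φ (fderiv ℝ Φ z) z :=
    fun z => (hH.differentiable one_ne_zero z).hasFDerivAt
  have hA : ∀ x t i,
      deriv (fun y => H (Function.update (p x t) i y) (q x t) t) (p x t i) = A i x t := by
    intro x t i
    refine HasDerivAt.deriv ?_
    refine HasFDerivAt.comp_hasDerivAt_of_eq (p x t i) (hΦd (p x t, q x t, t))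
      (f := fun y => (Function.update (p x t) i y, q x t, t))
      ((hasDerivAt_update (p x t) i (p x t i)).prodMk (hasDerivAt_const _ (q x t, t))) (by simp)
  have hB : ∀ x t i,
      deriv (fun y => H (p x t) (Function.update (q x t) i y) t) (q x t i) = B i x t := by
    intro x t i
    refine HasDerivAt.deriv ?_
    refine HasFDerivAt.comp_hasDerivAt_of_eq (q x t i) (hΦd (p x t, q x t, t))
      (f := fun y => (p x t, Function.update (q x t) i y, t))
      ((hasDerivAt_const _ (p x t)).prodMk
        ((hasDerivAt_update (q x t) i (q x t i)).prodMk (hasDerivAt_const _ t))) (by simp)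
  simp only [hA, hB] at hham
  have hγ : ContDiffOn ℝ 1 (fun z : ℝ × ℝ => (p z.1 z.2, q z.1 z.2, z.2)) (J ×ˢ Icc t₁ t₂) :=
    hp.prodMk (hq.prodMk contDiffOn_snd)
  have hD : ContinuousOn (fun z : ℝ × ℝ => D z.1 z.2) (J ×ˢ Icc t₁ t₂) :=
    (hH.continuous_fderiv one_ne_zero).comp_continuousOn hγ.continuousOn
  have hpc : ∀ x ∈ J, ∀ i, ContinuousOn (fun t => p x t i) (Icc t₁ t₂) := fun x hx i =>
    continuousOn_pi.1 (continuousOn_section_right hp.continuousOn hx) i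
  have hqc : ∀ x ∈ J, ∀ i, ContinuousOn (fun t => q x t i) (Icc t₁ t₂) := fun x hx i =>
    continuousOn_pi.1 (continuousOn_section_right hq.continuousOn hx) i
  have hAc : ∀ x ∈ J, ∀ i, ContinuousOn (A i x) (Icc t₁ t₂) := fun x hx i =>
    (continuousOn_section_right hD hx).clm_apply continuousOn_const
  have hBc : ∀ x ∈ J, ∀ i, ContinuousOn (B i x) (Icc t₁ t₂) := fun x hx i =>
    (continuousOn_section_right hD hx).clm_apply continuousOn_const
  have hHc : ∀ x ∈ J, ContinuousOn (fun t => H (p x t) (q x t) t) (Icc t₁ t₂) := fun x hx =>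
    continuousOn_section_right (hH.comp_contDiffOn hγ).continuousOn hx
  let ℓ : ℝ → ℝ → ℝ := fun x t => (∑ i, p x t i * A i x t) - H (p x t) (q x t) t
  have hℓc : ∀ x ∈ J, ContinuousOn (ℓ x) (Icc t₁ t₂) := fun x hx =>
    (continuousOn_finsetSum _ fun i _ => (hpc x hx i).mul (hAc x hx i)).sub (hHc x hx)
  have hu : uIcc t₁ t₂ = Icc t₁ t₂ := uIcc_of_le ht.le
  have hSℓ : ∀ x ∈ J, S x = ∫ t in t₁..t₂, ℓ x t := by
    intro x hx
    rw [hS]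
    refine intervalIntegral.integral_congr fun t htt => ?_
    rw [hu] at htt
    simp only [ℓ, fun i => (hham x hx t htt i).1.deriv]
  let G : ℝ → ℝ → ℝ := fun x t => ∑ i, p x t i * (q x t i - q m t i)
  let G' : ℝ → ℝ → ℝ := fun x t =>
    ∑ i, (-B i x t * (q x t i - q m t i) + p x t i * (A i x t - A i m t))
  have hG'c : ∀ x ∈ J, ContinuousOn (G' x) (Icc t₁ t₂) := fun x hx =>
    continuousOn_finsetSum _ fun i _ =>
      ((hBc x hx i).neg.mul ((hqc x hx i).sub (hqc m hm i))).add
        ((hpc x hx i).mul ((hAc x hx i).sub (hAc m hm i)))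
  have hG : ∀ x ∈ J, ∫ t in t₁..t₂, G' x t = G x t₂ - G x t₁ := by
    intro x hx
    refine intervalIntegral.integral_eq_sub_of_hasDerivAt (fun t htt => ?_)
      (hu ▸ hG'c x hx).intervalIntegrable
    rw [hu] at htt
    exact HasDerivAt.fun_sum fun i _ =>
      (hham x hx t htt i).2.mul ((hham x hx t htt i).1.sub (hham m hm t htt i).1)
  have hR : ∀ x t, actionRemainder Φ p q m x t = ℓ x t - ℓ m t - G' x t := by
    intro x t
    have e1 : fderiv ℝ Φ (p x t, q x t, t) (0, q x t - q m t, 0)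
        = ∑ i, B i x t * (q x t i - q m t i) :=
      clm_pi_apply_eq_sum ((D x t).comp ((ContinuousLinearMap.inr ℝ (Fin n → ℝ) _).comp
        (ContinuousLinearMap.inl ℝ (Fin n → ℝ) ℝ))) (q x t - q m t)
    have e2 : fderiv ℝ Φ (p m t, q m t, t) (p x t - p m t, 0, 0)
        = ∑ i, A i m t * (p x t i - p m t i) :=
      clm_pi_apply_eq_sum ((D m t).comp (ContinuousLinearMap.inl ℝ (Fin n → ℝ) _))
        (p x t - p m t)
    have e3 : (∑ i, B i x t * (q x t i - q m t i)) + ∑ i, A i m t * (p x t i - p m t i)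
        = (∑ i, p x t i * A i x t) - (∑ i, p m t i * A i m t) - G' x t := by
      simp only [G', ← Finset.sum_add_distrib, ← Finset.sum_sub_distrib]
      exact Finset.sum_congr rfl fun i _ => by ring
    rw [actionRemainder, e1, e2, e3]
    simp only [ℓ, hΦ]
    ring
  have hrep : S =ᶠ[𝓝 m] fun x =>
      S m + (G x t₂ - G x t₁) + ∫ t in t₁..t₂, actionRemainder Φ p q m x t := by
    filter_upwards [hJo.mem_nhds hm] with x hx
    have ix := (hu ▸ hℓc x hx : ContinuousOn (ℓ x) (uIcc t₁ t₂)).intervalIntegrable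
      (μ := MeasureTheory.volume)
    have im := (hu ▸ hℓc m hm : ContinuousOn (ℓ m) (uIcc t₁ t₂)).intervalIntegrable
      (μ := MeasureTheory.volume)
    have iG := (hu ▸ hG'c x hx : ContinuousOn (G' x) (uIcc t₁ t₂)).intervalIntegrable
      (μ := MeasureTheory.volume)
    simp only [hR]
    rw [intervalIntegral.integral_sub (ix.sub im) iG, intervalIntegral.integral_sub ix im,
      hG x hx, ← hSℓ x hx, ← hSℓ m hm]
    ring
  have hGd : ∀ t ∈ Icc t₁ t₂, HasDerivAt (fun x => G x t)
      (∑ i, p m t i * deriv (fun m' => q m' t i) m) m := by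
    intro t htt
    refine HasDerivAt.fun_sum fun i _ => ?_
    have hpi : ContinuousAt (fun x => p x t i) m :=
      continuousAt_pi.1 (continuousAt_section_left hJo hp.continuousOn hm htt) i
    have hqi : DifferentiableAt ℝ (fun x => q x t i) m :=
      differentiableAt_pi.1 (differentiableAt_section_left hJo hq hm htt) i
    exact hasDerivAt_clm_apply_of_eq_zero (L := fun x => ContinuousLinearMap.mul ℝ ℝ (p x t i))
      ((ContinuousLinearMap.mul ℝ ℝ).continuous.continuousAt.comp hpi)
      (hqi.hasDerivAt.sub_const (q m t i)) (sub_self _)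
  have hmain := (((hGd t₂ (right_mem_Icc.2 ht.le)).sub (hGd t₁ (left_mem_Icc.2 ht.le))).const_add
    (S m)).add (hasDerivAt_integral_actionRemainder hH hJo ht.le hp hq hm)
  rw [add_zero] at hmain
  exact hmain.congr_of_eventuallyEq hrep
end
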